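/- Let Ω be a finite type, n ≥ 1, and let φ : Set Ω → ZMod 2 satisfy the order-n sum rule. Suppose Z₁, …, Z_m ⊆ Ω are sets whose symmetric difference Z₁ ∆ ⋯ ∆ Z_m equals Ω, and suppose that φ(∆_{i∈T} Z_i) = 0 for every nonempty index set T ⊆ {1, …, m} with |T| ≤ n. Then φ(Ω) = 0. (Hence, for a measure whose null sets include all such at-most-n-fold symmetric differences of the Z_i, there is no unital preclusive order-n co-event.) -/

import Mathlib

instance {Ω : Type*} : Std.Commutative (α := Set Ω) symmDiff := ⟨symmDiff_comm⟩
instance {Ω : Type*} : Std.Associative (α := Set Ω) symmDiff := ⟨symmDiff_assoc⟩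

/-- The symmetric difference `∆_{i ∈ s} A i` of a finite family of sets. -/
def finSymmDiff {ι Ω : Type*} (s : Finset ι) (A : ι → Set Ω) : Set Ω :=
  s.fold symmDiff ∅ A

/-- The order-`n` sum rule for a co-event `φ`: for all `A₁, …, A_{n+1}`,
`φ(A₁ ∆ ⋯ ∆ A_{n+1})` equals the sum (in `ZMod 2`) of `φ(∆_{i∈S} A_i)` over all
nonempty `S ⊆ {1, …, n+1}` with `|S| ≤ n`. -/
def OrderSumRule {Ω : Type*} (n : ℕ) (φ : Set Ω → ZMod 2) : Prop :=
  ∀ A : Fin (n + 1) → Set Ω,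
    φ (finSymmDiff Finset.univ A) =
      ∑ S ∈ Finset.univ.powerset.filter
          (fun S : Finset (Fin (n + 1)) => S.Nonempty ∧ S.card ≤ n),
        φ (finSymmDiff S A)

theorem finSymmDiff_const_empty {ι Ω : Type*} (s : Finset ι) :
    finSymmDiff s (fun _ => (∅ : Set Ω)) = ∅ := by
  classical
  induction s using Finset.induction_on with
  | empty => rfl
  | insert a s ha ih =>
    unfold finSymmDiff at ih ⊢
    rw [Finset.fold_insert ha, ih, symmDiff_self, Set.bot_eq_empty]

theorem finSymmDiff_disjUnion {ι Ω : Type*} {s t : Finset ι} (h : Disjoint s t)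
    (A : ι → Set Ω) :
    finSymmDiff (s.disjUnion t h) A = symmDiff (finSymmDiff s A) (finSymmDiff t A) := by
  have he : symmDiff (∅ : Set Ω) ∅ = ∅ := symmDiff_self _
  have hf := Finset.fold_disjUnion (op := symmDiff) (f := A) (b₁ := ∅) (b₂ := ∅) h
  rwa [he] at hf

/-- The symmetric difference over the fibers of `f` above `S` regroups into a single one. -/
theorem finSymmDiff_fiberwise {ι κ Ω : Type*} [DecidableEq κ] (T : Finset ι) (f : ι → κ)
    (S : Finset κ) (A : ι → Set Ω) :
    finSymmDiff S (fun k => finSymmDiff (T.filter (f · = k)) A) =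
      finSymmDiff (T.filter (f · ∈ S)) A := by
  classical
  induction S using Finset.induction_on with
  | empty => simp [finSymmDiff]
  | insert a S ha ih =>
    have hd : Disjoint (T.filter (f · = a)) (T.filter (f · ∈ S)) := by
      rw [Finset.disjoint_filter]
      rintro x - rfl
      exact ha
    have hT : T.filter (f · ∈ insert a S) =
        (T.filter (f · = a)).disjUnion (T.filter (f · ∈ S)) hd := by
      ext x
      simp only [Finset.mem_filter, Finset.mem_insert, Finset.mem_disjUnion]
      tauto
    rw [hT, finSymmDiff_disjUnion, ← ih]
    exact Finset.fold_insert ha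

theorem OrderSumRule.map_empty {Ω : Type*} {n : ℕ} {φ : Set Ω → ZMod 2}
    (hφ : OrderSumRule n φ) : φ ∅ = 0 := by
  have h := hφ fun _ => ∅
  simp only [finSymmDiff_const_empty] at h
  rw [h]
  refine Finset.sum_involution (fun S _ => Sᶜ) (fun _ _ => CharTwo.add_self_eq_zero _)
    (fun S _ _ => compl_ne_self) (fun S hS => ?_) (fun S _ => compl_compl S)
  simp only [Finset.mem_filter, Finset.mem_powerset, Finset.subset_univ, true_and,
    ← Finset.card_pos, Finset.card_compl, Fintype.card_fin] at hS ⊢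
  omega

/-- A co-event of order `n` vanishes on every symmetric difference of a family as soon as it
vanishes on those with at most `n` members. -/
theorem OrderSumRule.map_finSymmDiff_eq_zero {ι Ω : Type*} {n : ℕ} {φ : Set Ω → ZMod 2}
    (hφ : OrderSumRule n φ) (Z : ι → Set Ω)
    (hnull : ∀ T : Finset ι, T.Nonempty → T.card ≤ n → φ (finSymmDiff T Z) = 0)
    (T : Finset ι) : φ (finSymmDiff T Z) = 0 := by
  classical
  induction T using Finset.strongInduction with
  | H T ih =>
  rcases T.eq_empty_or_nonempty with rfl | hT
  · exact hφ.map_empty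
  rcases le_or_gt T.card n with hn | hn
  · exact hnull T hT hn
  obtain ⟨e⟩ : Nonempty (Fin (n + 1) ↪ T) :=
    Function.Embedding.nonempty_of_card_le (by simpa using hn)
  have : Nonempty ι := hT.to_type
  let f : ι → Fin (n + 1) := Function.invFun fun i => (e i : ι)
  have hf : ∀ i, f (e i) = i :=
    Function.leftInverse_invFun (Subtype.val_injective.comp e.injective)
  have h := hφ fun k => finSymmDiff (T.filter (f · = k)) Z
  simp only [finSymmDiff_fiberwise, Finset.mem_univ, Finset.filter_true] at h
  rw [h]
  refine Finset.sum_eq_zero fun S hS => ih _ ?_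
  obtain ⟨-, -, hcard⟩ := Finset.mem_filter.1 hS
  obtain ⟨k, hk⟩ : ∃ k, k ∉ S := by
    by_contra! hall
    rw [Finset.eq_univ_iff_forall.2 hall, Finset.card_fin] at hcard
    omega
  exact Finset.filter_ssubset.2 ⟨e k, (e k).2, by rwa [hf]⟩

/-- If `Z₁ ∆ ⋯ ∆ Z_m = Ω` and an order-`n` co-event `φ` vanishes on every at-most-`n`-fold
symmetric difference of the `Z_i`, then `φ(Ω) = 0`: no order-`n` co-event precluding these
sets can be unital. -/
theorem orderN_problem_structure_prevents_unitality {Ω : Type*} [Fintype Ω] (n : ℕ)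
    (hn : 1 ≤ n) (φ : Set Ω → ZMod 2) (hφ : OrderSumRule n φ)
    (m : ℕ) (Z : Fin m → Set Ω)
    (hcover : finSymmDiff Finset.univ Z = Set.univ)
    (hnull : ∀ T : Finset (Fin m), T.Nonempty → T.card ≤ n →
      φ (finSymmDiff T Z) = 0) :
    φ Set.univ = 0 := by
  rw [← hcover]
  exact hφ.map_finSymmDiff_eq_zero Z hnull Finset.univ
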